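/- arXiv:2002.10139 — 14 statements merged into one kernel-verified Lean document; each statement's English description precedes it below -/
import Mathlib

section
/- Let R be a commutative ring and I an ideal of R. Then I is a pure ideal if and only if for every f ∈ I we have Ann(f) + I = R, where Ann(f) denotes the annihilator ideal {r ∈ R : r·f = 0}. -/
/-- An ideal `I` of a commutative ring `R` is pure (i.e. `R/I` is flat over `R`)
if and only if `Ann(f) + I = R` for all `f ∈ I`. -/
theorem pure_ideal_iff_ann_add_eq_top (R : Type*) [CommRing R] (I : Ideal R) :
    Module.Flat R (R ⧸ I) ↔ ∀ f ∈ I, Ideal.torsionOf R R f + I = ⊤ := by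
  constructor
  · intro hI f hf
    have : I.Pure := hI
    obtain ⟨y, hy, hfy⟩ := Ideal.exists_eq_mul_of_pure hf
    refine (Ideal.eq_top_iff_one _).2 (Submodule.mem_sup.2 ⟨1 - y, ?_, y, hy, by ring⟩)
    rw [Ideal.mem_torsionOf_iff, smul_eq_mul]
    linear_combination hfy
  · intro h
    refine Ideal.Pure.of_inf_eq_mul I fun J _ ↦ le_antisymm ?_ Ideal.mul_le_inf
    rintro f ⟨hfI, hfJ⟩
    obtain ⟨a, ha, y, hy, hay⟩ :=
      Submodule.mem_sup.1 ((Ideal.eq_top_iff_one _).1 (h f hfI))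
    rw [Ideal.mem_torsionOf_iff, smul_eq_mul] at ha
    have hfy : f = y * f := by linear_combination ha - f * hay
    rw [hfy]
    exact Ideal.mul_mem_mul hy hfJ
end

section
/- Let R be a commutative ring and M a finitely generated flat R-module. Then the annihilator Ann_R(M) = {r ∈ R : r·m = 0 for all m ∈ M} is a pure ideal of R. -/
/-- If `r` annihilates a finite flat module `M`, then `M = J • M` for `J` the annihilator of `r`,
so Nakayama's lemma gives an element `s` annihilating `M` with `r * s = r`. -/
theorem Module.Flat.exists_mem_annihilator_mul_eq_self {R M : Type*} [CommRing R] [AddCommGroup M]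
    [Module R M] [Module.Finite R M] [Module.Flat R M] {r : R}
    (hr : r ∈ Module.annihilator R M) : ∃ s ∈ Module.annihilator R M, r * s = r := by
  have hle : (⊤ : Submodule R M) ≤ LinearMap.ker (LinearMap.mul R R r) • (⊤ : Submodule R M) := by
    intro x _
    have hx : ∑ i : Fin 1, (fun _ => r) i • (fun _ => x : Fin 1 → M) i = 0 := by
      simpa using Module.mem_annihilator.mp hr x
    obtain ⟨k, a, y, hxy, ha⟩ := Module.Flat.isTrivialRelation_of_sum_smul_eq_zero hx
    rw [show x = _ from hxy 0]
    exact Submodule.sum_mem _ fun j _ =>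
      Submodule.smul_mem_smul (by simpa using ha j) Submodule.mem_top
  obtain ⟨s, hs, hsM⟩ := Submodule.exists_sub_one_mem_and_smul_eq_zero_of_fg_of_le_smul _ _
    Module.Finite.fg_top hle
  refine ⟨s, Module.mem_annihilator.mpr fun m => hsM m Submodule.mem_top, ?_⟩
  have hmul : r * (s - 1) = 0 := hs
  linear_combination hmul

/-- An ideal `I` is pure as soon as every `r ∈ I` is of the form `r * s` with `s ∈ I`. -/
theorem Ideal.flat_quotient_of_forall_exists_mul_eq_self {R : Type*} [CommRing R] (I : Ideal R)
    (hI : ∀ r ∈ I, ∃ s ∈ I, r * s = r) : Module.Flat R (R ⧸ I) := by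
  refine Module.Flat.of_forall_isTrivialRelation fun {l f x} hfx => ?_
  choose y hy using fun i => Ideal.Quotient.mk_surjective (x i)
  have hmem : ∑ i, f i * y i ∈ I := by
    rw [← Ideal.Quotient.eq_zero_iff_mem, map_sum, ← hfx]
    simp [← hy, Algebra.smul_def]
  obtain ⟨s, hs, hrs⟩ := hI _ hmem
  refine ⟨1, fun i _ => (1 - s) * y i, fun _ => 1, fun i => ?_, fun _ => ?_⟩
  · have hs0 : Ideal.Quotient.mk I s = 0 := Ideal.Quotient.eq_zero_iff_mem.mpr hs
    simp [← hy, Algebra.smul_def, hs0]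
  · calc ∑ i, f i * ((1 - s) * y i) = (1 - s) * ∑ i, f i * y i := by
          rw [Finset.mul_sum]
          exact Finset.sum_congr rfl fun i _ => by ring
      _ = 0 := by linear_combination -hrs

/-- The annihilator of a finitely generated flat module is a pure ideal. -/
theorem annihilator_of_fg_flat_is_pure (R M : Type*) [CommRing R] [AddCommGroup M]
    [Module R M] [Module.Finite R M] [Module.Flat R M] :
    Module.Flat R (R ⧸ Module.annihilator R M) :=
  Ideal.flat_quotient_of_forall_exists_mul_eq_self _ fun _ =>
    Module.Flat.exists_mem_annihilator_mul_eq_self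
end

section
/- Let R be a commutative ring and I an ideal of R. Then I is a pure ideal if and only if I = {f ∈ R : Ann(f) + I = R}. -/
/-- `Ann(f) + I = R` means that `f` is fixed by multiplication by some element of `I`. -/
theorem Ideal.torsionOf_add_eq_top_iff {R : Type*} [CommRing R] {I : Ideal R} {f : R} :
    Ideal.torsionOf R R f + I = ⊤ ↔ ∃ y ∈ I, f = f * y := by
  rw [Ideal.eq_top_iff_one, Submodule.add_eq_sup, Submodule.mem_sup]
  constructor
  · rintro ⟨a, ha, y, hy, h⟩
    rw [Ideal.mem_torsionOf_iff, smul_eq_mul] at ha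
    exact ⟨y, hy, by linear_combination (-f) * h + ha⟩
  · rintro ⟨y, hy, h⟩
    refine ⟨1 - y, ?_, y, hy, sub_add_cancel 1 y⟩
    rw [Ideal.mem_torsionOf_iff, smul_eq_mul]
    linear_combination h

/-- An ideal `I` of a commutative ring `R` is pure if and only if
`I = {f ∈ R : Ann(f) + I = R}`. -/
theorem pure_ideal_iff_eq_set_ann_add_eq_top (R : Type*) [CommRing R] (I : Ideal R) :
    Module.Flat R (R ⧸ I) ↔ (I : Set R) = {f : R | Ideal.torsionOf R R f + I = ⊤} := by
  simp only [Ideal.torsionOf_add_eq_top_iff]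
  constructor
  · intro h
    have : I.Pure := h
    refine Set.Subset.antisymm (fun f hf => ?_) ?_
    · obtain ⟨y, hy, h⟩ := Ideal.exists_eq_mul_of_pure hf
      exact ⟨y, hy, h⟩
    · rintro f ⟨y, hy, h⟩
      rw [SetLike.mem_coe, h]
      exact I.mul_mem_left f hy
  · intro h
    refine Ideal.Pure.of_inf_eq_mul I fun J _ => le_antisymm ?_ Ideal.mul_le_inf
    rintro f ⟨hfI, hfJ⟩
    obtain ⟨y, hy, hf⟩ : ∃ y ∈ I, f = f * y := h.subset hfI
    rw [hf, mul_comm f y]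
    exact Ideal.mul_mem_mul hy hfJ
end

section
/- Let R be a commutative ring and I an ideal of R. Then I is a pure ideal if and only if the support of I (the set of prime ideals p of R with I_p ≠ 0) equals the set of prime ideals of R that do not contain I, i.e. Supp(I) = Spec(R) \ V(I). -/
/-- An ideal `I` is pure if and only if every element of `I` is fixed by multiplication by some
element of `I`. -/
theorem Ideal.pure_iff_forall_exists_mul_eq {R : Type*} [CommRing R] {I : Ideal R} :
    I.Pure ↔ ∀ a ∈ I, ∃ b ∈ I, b * a = a := by
  refine ⟨fun _ a ha ↦ ?_, fun h ↦ Ideal.Pure.of_inf_eq_mul I fun J _ ↦ ?_⟩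
  · have hmem : a ∈ I ⊓ Ideal.span {a} := ⟨ha, Ideal.mem_span_singleton_self a⟩
    rw [Ideal.inf_eq_mul_of_pure] at hmem
    exact Ideal.mem_mul_span_singleton.mp hmem
  · refine le_antisymm (fun a ha ↦ ?_) Ideal.mul_le_inf
    obtain ⟨b, hb, hba⟩ := h a ha.1
    exact hba ▸ Ideal.mul_mem_mul hb ha.2

/-- The support of an ideal contains the complement of its zero locus. -/
theorem Ideal.compl_zeroLocus_subset_support {R : Type*} [CommRing R] (I : Ideal R) :
    (PrimeSpectrum.zeroLocus (I : Set R))ᶜ ⊆ Module.support R I := by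
  intro p hp
  obtain ⟨a, haI, hap⟩ := Set.not_subset.mp hp
  refine Module.mem_support_iff'.mpr ⟨⟨a, haI⟩, fun r hr hra ↦ ?_⟩
  have hmul : r * a = 0 := congrArg Subtype.val hra
  exact (p.isPrime.mem_or_mem (hmul ▸ p.asIdeal.zero_mem)).elim hr hap

/-- An ideal `I` of a commutative ring `R` is pure if and only if the support of `I`
(as an `R`-module) equals `Spec R \ V(I)`. -/
theorem pure_ideal_iff_support_eq_compl_zeroLocus (R : Type*) [CommRing R] (I : Ideal R) :
    Module.Flat R (R ⧸ I) ↔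
      Module.support R I = (PrimeSpectrum.zeroLocus (I : Set R))ᶜ := by
  rw [show Module.Flat R (R ⧸ I) ↔ _ from Ideal.pure_iff_forall_exists_mul_eq]
  constructor
  · refine fun h ↦ Set.Subset.antisymm (fun p hp hI ↦ ?_) I.compl_zeroLocus_subset_support
    obtain ⟨⟨a, ha⟩, hann⟩ := Module.mem_support_iff'.mp hp
    obtain ⟨b, hb, hba⟩ := h a ha
    refine hann (1 - b) (fun hmem ↦ ?_) (Subtype.ext ?_)
    · exact p.isPrime.ne_top ((Ideal.eq_top_iff_one _).mpr
        (by simpa using p.asIdeal.add_mem hmem (hI hb)))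
    · simp [sub_mul, hba]
  · intro h a ha
    have htop : I ⊔ Ideal.torsionOf R R a = ⊤ := by
      by_contra hne
      obtain ⟨m, hm, hle⟩ := Ideal.exists_le_maximal _ hne
      have hp : (⟨m, hm.isPrime⟩ : PrimeSpectrum R) ∉ Module.support R I :=
        h ▸ not_not_intro (le_sup_left.trans hle)
      obtain ⟨s, hs, hsa⟩ := Module.notMem_support_iff'.mp hp ⟨a, ha⟩
      exact hs (hle (Ideal.mem_sup_right (congrArg Subtype.val hsa)))
    obtain ⟨b, hb, c, hc, hbc⟩ := Submodule.mem_sup.mp ((Ideal.eq_top_iff_one _).mp htop)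
    refine ⟨b, hb, ?_⟩
    have hca : c * a = 0 := hc
    linear_combination a * hbc - hca
end

section
/- Let R be a commutative ring and I an ideal of R. Then I is a pure ideal if and only if for every prime ideal p of R, the localization I_p (the image of I in R_p, i.e. I·R_p) is either the zero ideal or all of R_p. -/
/-- If `R ⧸ I` is flat, every element of `I` is fixed by multiplication by an element of `I`. -/
theorem Ideal.exists_mem_mul_eq_self_of_flat_quotient {R : Type*} [CommRing R] {I : Ideal R}
    [Module.Flat R (R ⧸ I)] {x : R} (hx : x ∈ I) : ∃ y ∈ I, x * y = x := by
  have hrel : ∑ i : Unit, (fun _ ↦ x) i • (fun _ ↦ (1 : R ⧸ I)) i = 0 := by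
    simpa [Algebra.smul_def] using Ideal.Quotient.eq_zero_iff_mem.mpr hx
  obtain ⟨k, a, y, hy, ha⟩ := Module.Flat.isTrivialRelation_of_sum_smul_eq_zero hrel
  choose r hr using fun j ↦ Ideal.Quotient.mk_surjective (y j)
  refine ⟨1 - ∑ j, a () j * r j, ?_, ?_⟩
  · have h1 := hy ()
    rw [← Ideal.Quotient.eq_zero_iff_mem, map_sub, map_one, map_sum, sub_eq_zero]
    simpa [Algebra.smul_def, hr] using h1
  · have h0 : ∀ j, x * a () j = 0 := fun j ↦ by simpa using ha j
    simp [mul_sub, Finset.mul_sum, ← mul_assoc, h0]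

/-- If every element of `I` is fixed by multiplication by an element of `I`,
then `R ⧸ I` is flat. -/
theorem Ideal.flat_quotient_of_forall_exists_mem_mul_eq_self {R : Type*} [CommRing R]
    {I : Ideal R} (h : ∀ x ∈ I, ∃ y ∈ I, x * y = x) : Module.Flat R (R ⧸ I) := by
  refine Module.Flat.of_forall_isTrivialRelation fun {l f x} hfx ↦ ?_
  choose r hr using fun i ↦ Ideal.Quotient.mk_surjective (x i)
  have hmem : ∑ i, f i * r i ∈ I := by
    rw [← Ideal.Quotient.eq_zero_iff_mem, map_sum]
    simpa [Algebra.smul_def, hr] using hfx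
  obtain ⟨y, hyI, hy⟩ := h _ hmem
  refine ⟨1, fun i _ ↦ r i * (1 - y), fun _ ↦ 1, fun i ↦ ?_, fun _ ↦ ?_⟩
  · simp [Algebra.smul_def, hr, Ideal.Quotient.eq_zero_iff_mem.mpr hyI]
  · simp only [← mul_assoc, ← Finset.sum_mul]
    rw [mul_sub, mul_one, hy, sub_self]

/-- An ideal `I` of a commutative ring `R` is pure if and only if for every prime
ideal `p` the localization `I·R_p` is either the zero ideal or all of `R_p`. -/
theorem pure_ideal_iff_localization_bot_or_top (R : Type*) [CommRing R] (I : Ideal R) :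
    Module.Flat R (R ⧸ I) ↔
      ∀ (p : Ideal R) [p.IsPrime],
        Ideal.map (algebraMap R (Localization.AtPrime p)) I = ⊥ ∨
        Ideal.map (algebraMap R (Localization.AtPrime p)) I = ⊤ := by
  refine ⟨fun _ p _ ↦ ?_, fun h ↦ ?_⟩
  · by_cases hIp : I ≤ p
    · refine .inl ((Ideal.map_eq_bot_iff_le_ker _).mpr fun x hx ↦ ?_)
      obtain ⟨y, hyI, hy⟩ := Ideal.exists_mem_mul_eq_self_of_flat_quotient hx
      rw [RingHom.mem_ker, IsLocalization.map_eq_zero_iff p.primeCompl]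
      refine ⟨⟨1 - y, fun hp ↦ ?_⟩, ?_⟩
      · exact (Ideal.ne_top_iff_one p).mp ‹p.IsPrime›.ne_top
          (by simpa using add_mem hp (hIp hyI))
      · linear_combination -hy
    · obtain ⟨x, hxI, hxp⟩ := SetLike.not_le_iff_exists.mp hIp
      exact .inr (Ideal.eq_top_of_isUnit_mem _ (Ideal.mem_map_of_mem _ hxI)
        (IsLocalization.map_units _ (⟨x, hxp⟩ : p.primeCompl)))
  · refine Ideal.flat_quotient_of_forall_exists_mem_mul_eq_self fun x hx ↦ ?_
    have htop : (Ideal.span {x}).annihilator ⊔ I = ⊤ := by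
      by_contra hne
      obtain ⟨m, hm, hle⟩ := Ideal.exists_le_maximal _ hne
      have hIm : I ≤ m := le_sup_right.trans hle
      rcases h m with hbot | htop
      · have hx0 : algebraMap R (Localization.AtPrime m) x = 0 :=
          (Ideal.map_eq_bot_iff_le_ker _).mp hbot hx
        obtain ⟨s, hs⟩ := (IsLocalization.map_eq_zero_iff m.primeCompl _ _).mp hx0
        exact s.2 (hle (Ideal.mem_sup_left
          (Submodule.mem_annihilator_span_singleton x (s : R) |>.mpr hs)))
      · have hmax : Ideal.map (algebraMap R (Localization.AtPrime m)) m = ⊤ :=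
          top_le_iff.mp (htop ▸ Ideal.map_mono hIm)
        rw [Localization.AtPrime.map_eq_maximalIdeal] at hmax
        exact (IsLocalRing.maximalIdeal.isMaximal _).ne_top hmax
    obtain ⟨a, ha, y, hy, hay⟩ := Submodule.mem_sup.mp ((Ideal.eq_top_iff_one _).mp htop)
    have hax : a * x = 0 := (Submodule.mem_annihilator_span_singleton x a).mp ha
    exact ⟨y, hy, by linear_combination x * hay - hax⟩
end

section
/- Let R be a commutative ring. If every maximal ideal of R is a quasi-pure ideal, then R is zero-dimensional, i.e. every prime ideal of R is a maximal ideal. -/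
/-- If every maximal ideal of a commutative ring `R` is quasi-pure, then `R` is
zero-dimensional: every prime ideal is maximal. -/
theorem zero_dimensional_of_maximal_quasi_pure (R : Type*) [CommRing R]
    (h : ∀ m : Ideal R, m.IsMaximal →
      ∀ f ∈ m, ∃ n : ℕ, 1 ≤ n ∧ Ideal.torsionOf R R (f ^ n) + m = ⊤) :
    ∀ p : Ideal R, p.IsPrime → p.IsMaximal := by
  intro p hp
  obtain ⟨m, hm, hpm⟩ := p.exists_le_maximal hp.ne_top
  suffices hmp : m ≤ p from le_antisymm hpm hmp ▸ hm
  intro f hf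
  obtain ⟨n, -, hn⟩ := h m hm f hf
  obtain ⟨a, ha, b, hb, hab⟩ := Submodule.mem_sup.mp ((Ideal.eq_top_iff_one _).mp hn)
  have ham : a ∉ m := fun ham ↦
    hm.ne_top ((Ideal.eq_top_iff_one m).mpr (hab ▸ m.add_mem ham hb))
  have hmul : a * f ^ n = 0 := (Ideal.mem_torsionOf_iff _ _).mp ha
  have hmem : a * f ^ n ∈ p := hmul ▸ p.zero_mem
  exact hp.mem_of_pow_mem n ((hp.mem_or_mem hmem).resolve_left fun hap ↦ ham (hpm hap))
end

section
/- Let R be a commutative ring. If every maximal ideal of R is a pure ideal, then R is absolutely flat (von Neumann regular), i.e. for every f ∈ R there exists g ∈ R with f = f²·g. -/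
/-- If every maximal ideal of a commutative ring `R` is a pure ideal, then `R` is
absolutely flat (von Neumann regular): every `f` satisfies `f = f² * g` for some `g`. -/
theorem absolutely_flat_of_maximal_pure (R : Type*) [CommRing R]
    (h : ∀ m : Ideal R, m.IsMaximal → Module.Flat R (R ⧸ m)) :
    ∀ f : R, ∃ g : R, f = f ^ 2 * g := by
  intro f
  let J : Ideal R := Submodule.comap (LinearMap.mulLeft R f) (Ideal.span {f ^ 2})
  have mem_J (x : R) : x ∈ J ↔ f ^ 2 ∣ f * x := by
    simp [J, Ideal.mem_span_singleton]
  suffices hJ : J = ⊤ by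
    simpa [Dvd.dvd] using (mem_J 1).1 (hJ ▸ Submodule.mem_top)
  by_contra hJ
  obtain ⟨m, hm, hJm⟩ := J.exists_le_maximal hJ
  have : m.Pure := h m hm
  obtain ⟨y, hy, hfy⟩ := Ideal.exists_eq_mul_of_pure (hJm ((mem_J f).2 (by rw [sq])))
  have hy' : 1 - y ∈ m := hJm ((mem_J _).2 (by simp [mul_sub, ← hfy]))
  exact hm.ne_top ((Ideal.eq_top_iff_one m).2 (by simpa using m.add_mem hy' hy))
end

section
/- Let R be a commutative ring and M a finitely generated projective R-module. Then the annihilator Ann_R(M) = {r ∈ R : r·m = 0 for all m ∈ M} is generated by a single idempotent element of R. -/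
/-- The annihilator of a finitely generated projective module is generated by an
idempotent element. -/
theorem annihilator_of_fg_projective_eq_span_idempotent (R M : Type*) [CommRing R]
    [AddCommGroup M] [Module R M] [Module.Finite R M] [Module.Projective R M] :
    ∃ g : R, IsIdempotentElem g ∧ Module.annihilator R M = Ideal.span {g} := by
  obtain ⟨n, f, s, -, -, hfs⟩ := Module.Finite.exists_comp_eq_id_of_projective R M
  -- The ideal generated by the coordinates of all elements of `M` fixes `M`
  -- and is killed by the annihilator.
  let T : Ideal R := Ideal.span {x | ∃ m i, s m i = x}
  have hT : (⊤ : Submodule R M) ≤ T • ⊤ := by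
    intro m _
    have hm : m = ∑ i, s m i • f (Pi.single i 1) := by
      conv_lhs => rw [← LinearMap.id_apply (R := R) m, ← hfs, LinearMap.comp_apply,
        pi_eq_sum_univ' (s m)]
      simp [Pi.single]
    rw [hm]
    exact Submodule.sum_mem _ fun i _ =>
      Submodule.smul_mem_smul (Ideal.subset_span ⟨m, i, rfl⟩) trivial
  obtain ⟨r, hrT, hr⟩ := Submodule.exists_mem_and_smul_eq_self_of_fg_of_le_smul T ⊤
    Module.Finite.fg_top hT
  have hann : ∀ a ∈ Module.annihilator R M, a * r = 0 := by
    intro a ha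
    have hle : T ≤ LinearMap.ker (LinearMap.mulLeft R a) := by
      refine Ideal.span_le.mpr ?_
      rintro _ ⟨m, i, rfl⟩
      have h : s (a • m) i = 0 := by simp [Module.mem_annihilator.mp ha m]
      simpa using h
    simpa using hle hrT
  have hmem : 1 - r ∈ Module.annihilator R M :=
    Module.mem_annihilator.mpr fun m => by rw [sub_smul, one_smul, hr m trivial, sub_self]
  refine ⟨1 - r, ?_, le_antisymm (fun a ha => ?_) ?_⟩
  · rw [IsIdempotentElem, mul_sub, mul_one, hann _ hmem, sub_zero]
  · exact Ideal.mem_span_singleton.mpr ⟨a, by linear_combination hann a ha⟩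
  · exact (Ideal.span_singleton_le_iff_mem _).mpr hmem
end

section
/- Let R be a commutative ring, M an R-module, and x ∈ M. Then the cyclic submodule R·x is a projective R-module if and only if the annihilator Ann(x) = {r ∈ R : r·x = 0} is generated by an idempotent element of R. -/
/-- The quotient of a commutative ring by the ideal generated by an idempotent is projective. -/
theorem IsIdempotentElem.projective_quotient_span {R : Type*} [CommRing R] {e : R}
    (he : IsIdempotentElem e) : Module.Projective R (R ⧸ Ideal.span {e}) := by
  refine Module.Projective.of_split
    ((Ideal.span {e}).liftQ (LinearMap.mulLeft R (1 - e)) ?_) (Ideal.span {e}).mkQ ?_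
  · refine Ideal.span_le.mpr ?_
    rintro _ rfl
    simp [sub_mul, he.eq]
  · refine Submodule.linearMap_qext _ (LinearMap.ext_ring ?_)
    refine (Submodule.Quotient.eq _).mpr ?_
    change (1 - e) * 1 - 1 ∈ Ideal.span {e}
    simp

/-- If the cyclic submodule generated by `x` is projective, then the annihilator of `x` is
generated by an idempotent. -/
theorem Ideal.exists_torsionOf_eq_span_idempotent {R M : Type*} [CommRing R]
    [AddCommGroup M] [Module R M] (x : M) [Module.Projective R (Submodule.span R {x})] :
    ∃ e : R, IsIdempotentElem e ∧ Ideal.torsionOf R M x = Ideal.span {e} := by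
  let y : Submodule.span R {x} := ⟨x, Submodule.mem_span_singleton_self x⟩
  have hsurj : LinearMap.range (LinearMap.toSpanSingleton R _ y) = ⊤ := by
    rw [LinearMap.range_eq_top]
    rintro ⟨z, hz⟩
    obtain ⟨r, rfl⟩ := Submodule.mem_span_singleton.mp hz
    exact ⟨r, rfl⟩
  obtain ⟨s, hs⟩ := LinearMap.exists_rightInverse_of_surjective _ hsurj
  have hsy : s y • x = x := congrArg Subtype.val (LinearMap.congr_fun hs y)
  have hann : ∀ r : R, r • x = 0 → r * s y = 0 := fun r hr => by
    have hry : r • y = 0 := Subtype.ext hr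
    rw [← smul_eq_mul, ← map_smul, hry, map_zero]
  have he : (1 - s y) • x = 0 := by rw [sub_smul, one_smul, hsy, sub_self]
  refine ⟨1 - s y, ?_, le_antisymm (fun r hr => ?_) ?_⟩
  · rw [IsIdempotentElem, mul_sub, mul_one, hann _ he, sub_zero]
  · rw [Ideal.mem_torsionOf_iff] at hr
    refine Ideal.mem_span_singleton'.mpr ⟨r, ?_⟩
    rw [mul_sub, mul_one, hann r hr, sub_zero]
  · rw [Ideal.span_singleton_le_iff_mem, Ideal.mem_torsionOf_iff]
    exact he

/-- For an element `x` of an `R`-module `M`, the cyclic submodule `R·x` is projective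
if and only if `Ann(x)` is generated by an idempotent of `R`. -/
theorem cyclic_projective_iff_ann_span_idempotent (R M : Type*) [CommRing R]
    [AddCommGroup M] [Module R M] (x : M) :
    Module.Projective R ↥(Submodule.span R {x}) ↔
      ∃ e : R, IsIdempotentElem e ∧ Ideal.torsionOf R M x = Ideal.span {e} := by
  refine ⟨fun _ => Ideal.exists_torsionOf_eq_span_idempotent x, ?_⟩
  rintro ⟨e, he, h⟩
  have : Module.Projective R (R ⧸ Ideal.torsionOf R M x) := h ▸ he.projective_quotient_span
  exact .of_equiv' (Ideal.quotTorsionOfEquivSpanSingleton R M x)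
end

section
/- Let φ : R → S be a morphism of commutative rings and M a projective R-module. Then the trace ideal of the S-module M ⊗_R S equals the extension of the trace ideal of M along φ: tr_S(M ⊗_R S) = tr_R(M)·S (the ideal of S generated by φ(tr_R(M))). -/
open TensorProduct

/-- The trace ideal of a module `M`: the sum of the ranges of all linear maps `M → R`. -/
def traceIdeal (R : Type*) [CommRing R] (M : Type*) [AddCommGroup M] [Module R M] :
    Ideal R :=
  ⨆ f : M →ₗ[R] R, LinearMap.range f

theorem apply_mem_traceIdeal {R M : Type*} [CommRing R] [AddCommGroup M] [Module R M]
    (f : M →ₗ[R] R) (m : M) : f m ∈ traceIdeal R M :=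
  le_iSup (fun f : M →ₗ[R] R => LinearMap.range f) f ⟨m, rfl⟩

theorem traceIdeal_le_iff {R M : Type*} [CommRing R] [AddCommGroup M] [Module R M]
    {I : Ideal R} : traceIdeal R M ≤ I ↔ ∀ (f : M →ₗ[R] R) (m : M), f m ∈ I := by
  refine ⟨fun h f m => h (apply_mem_traceIdeal f m), fun h => iSup_le fun f => ?_⟩
  rintro _ ⟨m, rfl⟩
  exact h f m

/-- A projective module is contained in its multiple by its own trace ideal. -/
theorem traceIdeal_smul_top (R M : Type*) [CommRing R] [AddCommGroup M] [Module R M]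
    [Module.Projective R M] : traceIdeal R M • (⊤ : Submodule R M) = ⊤ := by
  refine eq_top_iff.2 fun m _ => ?_
  obtain ⟨s, hs⟩ := Module.projective_def'.1 (inferInstance : Module.Projective R M)
  have hm : (s m).sum (fun p r => r • p) = m := by
    simpa [Finsupp.linearCombination_apply] using LinearMap.congr_fun hs m
  rw [← hm]
  exact Submodule.sum_mem _ fun p _ =>
    Submodule.smul_mem_smul (apply_mem_traceIdeal (Finsupp.lapply p ∘ₗ s) m) trivial

/-- If `R → S` is a morphism of commutative rings and `M` is a projective `R`-module,
then `tr_S(M ⊗_R S) = tr_R(M)·S`. -/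
theorem traceIdeal_baseChange (R S : Type*) [CommRing R] [CommRing S] [Algebra R S]
    (M : Type*) [AddCommGroup M] [Module R M] [Module.Projective R M] :
    traceIdeal S (S ⊗[R] M) = Ideal.map (algebraMap R S) (traceIdeal R M) := by
  apply le_antisymm
  · refine traceIdeal_le_iff.2 fun f x => ?_
    induction x with
    | zero => simp
    | add x y hx hy => simpa using add_mem hx hy
    | tmul s m =>
      rw [← mul_one s, ← smul_eq_mul, ← TensorProduct.smul_tmul', map_smul]
      refine Ideal.mul_mem_left _ s ?_
      have hm : m ∈ traceIdeal R M • (⊤ : Submodule R M) := by simp [traceIdeal_smul_top]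
      induction hm using Submodule.smul_induction_on' with
      | smul r hr p _ =>
        rw [TensorProduct.tmul_smul, ← algebraMap_smul S r, map_smul]
        exact Ideal.mul_mem_right _ _ (Ideal.mem_map_of_mem _ hr)
      | add x _ y _ hx hy => simpa [TensorProduct.tmul_add] using add_mem hx hy
  · refine Ideal.map_le_iff_le_comap.2 (traceIdeal_le_iff.2 fun f m => ?_)
    have h := apply_mem_traceIdeal
      ((TensorProduct.AlgebraTensorModule.rid R S S).toLinearMap ∘ₗ f.baseChange S) (1 ⊗ₜ[R] m)
    simpa [Algebra.smul_def] using h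
end

section
/- Let R be a commutative ring, M a projective R-module and N any R-module. Setting J = tr_R(M) and J' = tr_R(N), the trace ideal of the tensor product satisfies tr_R(M ⊗_R N) = J·J' = J ∩ J'. -/
open TensorProduct

theorem traceIdeal_mul_le_traceIdeal_tensor (R M N : Type*) [CommRing R]
    [AddCommGroup M] [Module R M] [AddCommGroup N] [Module R N] :
    traceIdeal R M * traceIdeal R N ≤ traceIdeal R (M ⊗[R] N) := by
  rw [traceIdeal.eq_1 R M, traceIdeal.eq_1 R N]
  simp only [Ideal.iSup_mul, Ideal.mul_iSup, iSup_le_iff]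
  intro g f
  rw [Ideal.mul_le]
  rintro _ ⟨m, rfl⟩ _ ⟨n, rfl⟩
  simpa using apply_mem_traceIdeal (LinearMap.mul' R R ∘ₗ TensorProduct.map f g) (m ⊗ₜ[R] n)

theorem traceIdeal_tensor_le_inf (R M N : Type*) [CommRing R]
    [AddCommGroup M] [Module R M] [AddCommGroup N] [Module R N] :
    traceIdeal R (M ⊗[R] N) ≤ traceIdeal R M ⊓ traceIdeal R N := by
  rw [traceIdeal_le_iff]
  intro f t
  induction t with
  | zero => simp
  | add x y hx hy => rw [map_add]; exact add_mem hx hy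
  | tmul m n =>
    exact ⟨apply_mem_traceIdeal (f ∘ₗ (TensorProduct.mk R M N).flip n) m,
      apply_mem_traceIdeal (f ∘ₗ TensorProduct.mk R M N m) n⟩

/-- Every element of a projective module is fixed by some element of the trace ideal. -/
theorem exists_mem_traceIdeal_smul_eq {R M : Type*} [CommRing R]
    [AddCommGroup M] [Module R M] [Module.Projective R M] (m : M) :
    ∃ e ∈ traceIdeal R M, e • m = m := by
  obtain ⟨s, hs⟩ := Module.projective_def'.mp ‹Module.Projective R M›
  have hsm (x : M) : ((s x).sum fun i r ↦ r • i) = x := by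
    simpa [Finsupp.linearCombination_apply] using LinearMap.congr_fun hs x
  let V : Ideal R := Ideal.span (s m '' (s m).support)
  have hV (k : M) : s m k ∈ V := by
    by_cases hk : k ∈ (s m).support
    · exact Ideal.subset_span ⟨k, hk, rfl⟩
    · rw [Finsupp.notMem_support_iff.mp hk]
      exact V.zero_mem
  have hle : V ≤ traceIdeal R M • V := by
    refine Ideal.span_le.mpr ?_
    rintro _ ⟨k, -, rfl⟩
    have hk : s m k = (s m).sum fun i r ↦ s i k * r := by
      conv_lhs => rw [← hsm m]
      simp [Finsupp.sum, Finsupp.finsetSum_apply, mul_comm]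
    rw [SetLike.mem_coe, hk]
    refine sum_mem fun i _ ↦ ?_
    exact Submodule.smul_mem_smul (apply_mem_traceIdeal (Finsupp.lapply k ∘ₗ s) i) (hV i)
  obtain ⟨r, hr, hrV⟩ := Submodule.exists_sub_one_mem_and_smul_eq_zero_of_fg_of_le_smul
    (traceIdeal R M) V (Submodule.fg_span ((s m).support.finite_toSet.image _)) hle
  have hrm : r • m = 0 := by
    rw [← hsm (r • m), map_smul, show r • s m = 0 from Finsupp.ext fun k ↦ hrV _ (hV k)]
    simp
  refine ⟨1 - r, ?_, by rw [sub_smul, one_smul, hrm, sub_zero]⟩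
  rw [← neg_sub]
  exact neg_mem hr

theorem exists_mem_traceIdeal_mul_eq {R M : Type*} [CommRing R]
    [AddCommGroup M] [Module R M] [Module.Projective R M] {x : R} (hx : x ∈ traceIdeal R M) :
    ∃ e ∈ traceIdeal R M, e * x = x := by
  refine Submodule.iSup_induction (motive := fun x ↦ ∃ e ∈ traceIdeal R M, e * x = x) _ hx
    ?_ ⟨0, zero_mem _, by simp⟩ ?_
  · rintro f _ ⟨m, rfl⟩
    obtain ⟨e, he, hem⟩ := exists_mem_traceIdeal_smul_eq (R := R) m
    exact ⟨e, he, by rw [← smul_eq_mul, ← map_smul, hem]⟩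
  · rintro x y ⟨a, ha, hax⟩ ⟨b, hb, hby⟩
    refine ⟨a + b - a * b, sub_mem (add_mem ha hb) (Ideal.mul_mem_left _ _ hb), ?_⟩
    linear_combination (1 - b) * hax + (1 - a) * hby

theorem traceIdeal_inf_le_mul {R M : Type*} [CommRing R]
    [AddCommGroup M] [Module R M] [Module.Projective R M] (I : Ideal R) :
    traceIdeal R M ⊓ I ≤ traceIdeal R M * I := by
  rintro x ⟨hx, hxI⟩
  obtain ⟨e, he, hex⟩ := exists_mem_traceIdeal_mul_eq hx
  rw [← hex]
  exact Ideal.mul_mem_mul he hxI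

/-- If `M` is projective, then for any module `N`,
`tr_R(M ⊗_R N) = tr_R(M) · tr_R(N) = tr_R(M) ∩ tr_R(N)`. -/
theorem traceIdeal_tensor_eq_mul_eq_inf (R M N : Type*) [CommRing R]
    [AddCommGroup M] [Module R M] [Module.Projective R M]
    [AddCommGroup N] [Module R N] :
    traceIdeal R (M ⊗[R] N) = traceIdeal R M * traceIdeal R N ∧
      traceIdeal R (M ⊗[R] N) = traceIdeal R M ⊓ traceIdeal R N := by
  have hmul := traceIdeal_mul_le_traceIdeal_tensor R M N
  have hinf := traceIdeal_tensor_le_inf R M N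
  have hpure := traceIdeal_inf_le_mul (M := M) (traceIdeal R N)
  exact ⟨le_antisymm (hinf.trans hpure) hmul, le_antisymm hinf (hpure.trans hmul)⟩
end

section
/- Let R be a commutative ring and I an ideal of R such that the trace ideal of I, viewed as an R-module, is all of R: tr_R(I) = R. Then I is a finitely generated ideal. -/
/-- Every element of the trace ideal of an ideal `I` multiplies `I` into a finitely generated
subideal of `I`. -/
theorem exists_fg_le_of_mem_traceIdeal {R : Type*} [CommRing R] {I : Ideal R} {r : R}
    (hr : r ∈ traceIdeal R I) : ∃ J : Ideal R, J.FG ∧ J ≤ I ∧ ∀ y ∈ I, r * y ∈ J := by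
  induction hr using Submodule.iSup_induction' with
  | mem f r hr =>
    obtain ⟨x, rfl⟩ := hr
    refine ⟨Ideal.span {(x : R)}, Submodule.fg_span_singleton _,
      (Ideal.span_singleton_le_iff_mem I).2 x.2, fun y hy => ?_⟩
    have hswap : y • x = (x : R) • (⟨y, hy⟩ : I) := Subtype.ext (mul_comm y x)
    have hfy : f x * y = x * f ⟨y, hy⟩ := by
      rw [mul_comm, ← smul_eq_mul, ← map_smul, hswap, map_smul, smul_eq_mul]
    exact hfy ▸ Ideal.mul_mem_right _ _ (Ideal.mem_span_singleton_self _)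
  | zero => exact ⟨⊥, Submodule.fg_bot, bot_le, by simp⟩
  | add r s _ _ hr hs =>
    obtain ⟨J, hJ, hJI, hrJ⟩ := hr
    obtain ⟨K, hK, hKI, hsK⟩ := hs
    refine ⟨J ⊔ K, Submodule.FG.sup hJ hK, sup_le hJI hKI, fun y hy => ?_⟩
    rw [add_mul]
    exact Submodule.add_mem_sup (hrJ y hy) (hsK y hy)

/-- If the trace ideal of an ideal `I` (viewed as an `R`-module) is all of `R`,
then `I` is finitely generated. -/
theorem fg_of_traceIdeal_eq_top (R : Type*) [CommRing R] (I : Ideal R)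
    (h : traceIdeal R I = ⊤) : I.FG := by
  obtain ⟨J, hJ, hJI, hIJ⟩ := exists_fg_le_of_mem_traceIdeal
    (show (1 : R) ∈ traceIdeal R I from h ▸ Submodule.mem_top)
  have hle : I ≤ J := fun y hy => by simpa using hIJ y hy
  exact le_antisymm hle hJI ▸ hJ
end

section
/- Let R be a commutative ring and I an ideal of R that is not contained in any minimal prime ideal of R. If I is projective as an R-module, then I is a finitely generated ideal. -/
/-- Any two elements of an ideal `I` satisfy `y * f x = x * f y` for a linear form `f` on `I`. -/
theorem Ideal.mul_linearMap_apply_comm {R : Type*} [CommRing R] {I : Ideal R} (f : I →ₗ[R] R)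
    (x y : I) : (y : R) * f x = (x : R) * f y := by
  have h : (y : R) • x = (x : R) • y := Subtype.ext (mul_comm _ _)
  simpa using congrArg f h

/-- If the values `f i (y i)` of linear forms on an ideal `I` generate the unit ideal,
then `I` is finitely generated. -/
theorem Ideal.fg_of_span_range_linearMap_apply_eq_top {R ι : Type*} [CommRing R] {I : Ideal R}
    (f : ι → I →ₗ[R] R) (y : ι → I)
    (h : Ideal.span (Set.range fun i => f i (y i)) = ⊤) : I.FG := by
  classical
  obtain ⟨c, hc⟩ := Finsupp.mem_span_range_iff_exists_finsupp.mp
    ((Ideal.eq_top_iff_one _).mp h)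
  refine ⟨c.support.image fun i => (y i : R), le_antisymm ?_ fun x hx => ?_⟩
  · refine Submodule.span_le.mpr fun z hz => ?_
    obtain ⟨i, -, rfl⟩ := Finset.mem_image.mp hz
    exact (y i).2
  · rw [← mul_one x, ← hc, Finsupp.sum, Finset.mul_sum]
    refine Submodule.sum_mem _ fun i hi => ?_
    have hcomm := Ideal.mul_linearMap_apply_comm (f i) ⟨x, hx⟩ (y i)
    have hmul : x * (c i • f i (y i)) = c i * f i ⟨x, hx⟩ * (y i : R) := by
      rw [smul_eq_mul]
      linear_combination (-c i) * hcomm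
    rw [hmul]
    exact Ideal.mul_mem_left _ _ (Submodule.subset_span (Finset.mem_image_of_mem _ hi))

/-- An ideal not contained in any minimal prime which is projective as a module
is finitely generated. -/
theorem fg_of_projective_not_le_minimal_prime (R : Type*) [CommRing R] (I : Ideal R)
    (hmin : ∀ p ∈ minimalPrimes R, ¬ I ≤ p) (hproj : Module.Projective R I) :
    I.FG := by
  obtain ⟨s, hs⟩ := Module.projective_def'.mp hproj
  let f : I → I →ₗ[R] R := fun y => Finsupp.lapply y ∘ₗ s
  refine Ideal.fg_of_span_range_linearMap_apply_eq_top f id ?_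
  by_contra hT
  obtain ⟨m, hm, hTm⟩ := Ideal.exists_le_maximal _ hT
  obtain ⟨p, hp, hpm⟩ := Ideal.exists_minimalPrimes_le (bot_le : (⊥ : Ideal R) ≤ m)
  have := Ideal.IsMinimalPrime.isPrime hp
  refine hmin p hp fun x hx => ?_
  set t : R := ∑ y ∈ (s ⟨x, hx⟩).support, f y y with ht
  have htm : t ∈ m :=
    Submodule.sum_mem _ fun y _ => hTm (Ideal.subset_span ⟨y, rfl⟩)
  have hxt : x = x * t := by
    have h := congrArg (Subtype.val : I → R) (LinearMap.congr_fun hs ⟨x, hx⟩)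
    simp only [LinearMap.comp_apply, Finsupp.linearCombination_apply, Finsupp.sum,
      LinearMap.id_apply, id, Submodule.coe_sum, Submodule.coe_smul, smul_eq_mul] at h
    rw [ht, Finset.mul_sum]
    refine h.symm.trans (Finset.sum_congr rfl fun y _ => ?_)
    rw [mul_comm]
    exact Ideal.mul_linearMap_apply_comm (f y) ⟨x, hx⟩ y
  have hzero : x * (1 - t) ∈ p := by
    rw [mul_sub, mul_one, ← hxt, sub_self]
    exact p.zero_mem
  refine (Ideal.IsPrime.mem_or_mem ‹_› hzero).resolve_right fun h1 => ?_
  refine hm.ne_top ((Ideal.eq_top_iff_one m).mpr ?_)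
  simpa using m.add_mem (hpm h1) htm
end

section
/- Let R be a commutative ring and I an ideal of R. Then I is quasi-pure (i.e. for each f ∈ I there exists a natural number n ≥ 1 with Ann(f^n) + I = R) if and only if for each f ∈ I there exists some g ∈ I such that f·(1 − g) is nilpotent. -/
/-- An ideal `I` is quasi-pure (for each `f ∈ I` there is `n ≥ 1` with
`Ann(fⁿ) + I = R`) if and only if for each `f ∈ I` there is `g ∈ I` such that
`f * (1 - g)` is nilpotent. -/
theorem quasi_pure_iff_nilpotent (R : Type*) [CommRing R] (I : Ideal R) :
    (∀ f ∈ I, ∃ n : ℕ, 1 ≤ n ∧ Ideal.torsionOf R R (f ^ n) + I = ⊤) ↔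
      ∀ f ∈ I, ∃ g ∈ I, IsNilpotent (f * (1 - g)) := by
  constructor
  · intro h f hf
    obtain ⟨n, hn, htop⟩ := h f hf
    obtain ⟨a, ha, g, hg, hag⟩ :=
      Submodule.mem_sup.mp ((Ideal.eq_top_iff_one _).mp htop)
    rw [Ideal.mem_torsionOf_iff, smul_eq_mul] at ha
    refine ⟨g, hg, n, ?_⟩
    obtain ⟨k, rfl⟩ := Nat.exists_eq_add_of_le' hn
    rw [← hag, add_sub_cancel_right, mul_pow, pow_succ a, mul_left_comm,
      mul_comm _ a, ha, mul_zero]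
  · intro h f hf
    obtain ⟨g, hg, n, hn⟩ := h f hf
    refine ⟨n + 1, Nat.le_add_left 1 n, (Ideal.eq_top_iff_one _).mpr ?_⟩
    refine Submodule.mem_sup.mpr
      ⟨(1 - g) ^ (n + 1), ?_, 1 - (1 - g) ^ (n + 1), ?_, add_sub_cancel _ _⟩
    · rw [Ideal.mem_torsionOf_iff, smul_eq_mul, mul_comm, ← mul_pow, pow_succ, hn, zero_mul]
    · refine I.mem_of_dvd ?_ hg
      simpa using sub_dvd_pow_sub_pow (1 : R) (1 - g) (n + 1)
end
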